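/- Assume e ∈ dcl(Σ). Then the connected component of the identity satisfies Gal^0_L(Σ, e) = ⋂_{e' ∈ acl(e)↾Σ} π_Σ[Aut_{e'e}(𝔠)], where the intersection ranges over all hyperimaginaries e' algebraic over e having a representative that is a tuple of realizations of Σ. -/

import Mathlib

/- Framework: relativized Lascar groups of a first-order theory over a
hyperimaginary, following "Relativized Galois groups of first order theories
over a hyperimaginary" by H. Lee and J. Lee. -/

open FirstOrder Cardinal Pointwise

universe u

namespace RelLascar

variable {L : FirstOrder.Language.{u, u}} {M : Type u} [L.Structure M]

/-- The group of automorphisms of the monster model `M`. -/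
instance : Group (M ≃[L] M) where
  mul f g := f.comp g
  one := FirstOrder.Language.Equiv.refl L M
  inv f := f.symm
  mul_assoc f g h := (FirstOrder.Language.Equiv.comp_assoc h g f).symm
  one_mul := FirstOrder.Language.Equiv.refl_comp
  mul_one := FirstOrder.Language.Equiv.comp_refl
  inv_mul_cancel := FirstOrder.Language.Equiv.symm_comp_self

/-- Automorphisms act on the monster model. -/
instance : MulAction (M ≃[L] M) M where
  smul f x := f x
  one_smul _ := rfl
  mul_smul _ _ _ := rfl

@[simp] theorem autSmul_def (f : M ≃[L] M) (x : M) : f • x = f x := rfl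

/-- The solution set in `M` of a set of formulas in variables `ι` with
parameters `prm : π → M`. -/
def SolSet {ι π : Type u} (p : Set (L.Formula (ι ⊕ π))) (prm : π → M) : Set (ι → M) :=
  {v | ∀ φ ∈ p, φ.Realize (Sum.elim v prm)}

/-- A set of `ι`-tuples is type-definable over the parameters `prm`. -/
def TypeDefinableOver {ι π : Type u} (prm : π → M) (X : Set (ι → M)) : Prop :=
  ∃ p : Set (L.Formula (ι ⊕ π)), X = SolSet p prm

/-- Two tuples have the same (complete) type over `∅`. -/
def SameTp {ι : Type u} (c d : ι → M) : Prop :=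
  ∀ φ : L.Formula ι, φ.Realize c ↔ φ.Realize d

/-- `M` is a monster model with degree of saturation and strong homogeneity `κ`:
`κ` is uncountable, tuples of size `< κ` with the same type are conjugate under an
automorphism, and every partial type in `< κ` variables over `< κ` parameters that
is finitely realized in `M` is realized in `M`.  ("Small" means of size `< κ`.) -/
def IsMonster (κ : Cardinal.{u}) (L : FirstOrder.Language.{u, u}) (M : Type u) [L.Structure M] : Prop :=
  ℵ₀ < κ ∧
  (∀ (ι : Type u) (c d : ι → M), #ι < κ → SameTp (L := L) (M := M) c d →
      ∃ f : M ≃[L] M, ∀ i, f (c i) = d i) ∧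
  (∀ (ι π : Type u) (prm : π → M) (p : Set (L.Formula (ι ⊕ π))), #ι < κ → #π < κ →
      (∀ q : Finset (L.Formula (ι ⊕ π)), ↑q ⊆ p →
        ∃ v : ι → M, ∀ φ ∈ (q : Set (L.Formula (ι ⊕ π))), φ.Realize (Sum.elim v prm)) →
      ∃ v : ι → M, v ∈ SolSet p prm)

variable (κ : Cardinal.{u})

section Hyperimaginary

/- The hyperimaginary `e = a_E`, where `E` is the `∅`-type-definable equivalence
relation defined by the set of formulas `pE` and `a : γ → M`. -/
variable {γ : Type u} (pE : Set (L.Formula (γ ⊕ γ))) (a : γ → M)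

/-- The relation defined by a set of formulas in variables `δ ⊕ δ` (with no
parameters); for `pE` this is the equivalence relation `E`. -/
def Frel {δ : Type u} (pF : Set (L.Formula (δ ⊕ δ))) (x y : δ → M) : Prop :=
  ∀ φ ∈ pF, φ.Realize (Sum.elim x y)

/-- The class of a tuple `x` under the relation defined by `pF`; for an
equivalence relation this is the hyperimaginary `x_F` (as a set of representatives). -/
def Fclass {δ : Type u} (pF : Set (L.Formula (δ ⊕ δ))) (x : δ → M) : Set (δ → M) :=
  {y | Frel pF x y}

/-- `Aut_e(𝔠)`: the subgroup of automorphisms fixing the hyperimaginary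
`e = a_E` setwise. -/
def AutE : Subgroup (M ≃[L] M) := MulAction.stabilizer (M ≃[L] M) (Fclass pE a)

/-- `Aut_e(𝔠)` as a group. -/
abbrev Ge := ↥(AutE pE a)

/-- The hyperimaginary `e` is definable over the tuple `t` (i.e. `e ∈ dcl(t)`):
every automorphism fixing `t` pointwise fixes `e`. -/
def eInDclTuple {ι : Type u} (t : ι → M) : Prop :=
  ∀ f : M ≃[L] M, (∀ i, f (t i) = t i) → f ∈ AutE pE a

/-- The set of elements of `Aut_e(𝔠)` fixing pointwise some small elementary
substructure (model) `N` with `e ∈ dcl(N)`. -/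
def modelFixers : Set (Ge pE a) :=
  {f | ∃ N : L.ElementarySubstructure M, #N < κ ∧
        (∀ g : M ≃[L] M, (∀ x ∈ N, g x = x) → g ∈ AutE pE a) ∧
        ∀ x ∈ N, (f : M ≃[L] M) x = x}

/-- `Autf_L(𝔠, e)`: the normal subgroup of `Aut_e(𝔠)` generated by the
pointwise stabilizers of small models `N` with `e ∈ dcl(N)`. -/
def AutfL : Subgroup (Ge pE a) := Subgroup.normalClosure (modelFixers κ pE a)

/-- `c ≡ᴸ_e d` : the tuples have the same Lascar strong type over `e`. -/
def LEq {ι : Type u} (c d : ι → M) : Prop := ∃ f ∈ AutfL κ pE a, f • c = d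

theorem LEq.refl {ι : Type u} (c : ι → M) : LEq κ pE a c c :=
  ⟨1, one_mem _, one_smul _ _⟩

theorem LEq.symm {ι : Type u} {c d : ι → M} (h : LEq κ pE a c d) : LEq κ pE a d c := by
  obtain ⟨f, hf, rfl⟩ := h
  exact ⟨f⁻¹, inv_mem hf, inv_smul_smul f c⟩

theorem LEq.trans {ι : Type u} {c d e : ι → M} (h1 : LEq κ pE a c d)
    (h2 : LEq κ pE a d e) : LEq κ pE a c e := by
  obtain ⟨f, hf, rfl⟩ := h1
  obtain ⟨g, hg, rfl⟩ := h2
  exact ⟨g * f, mul_mem hg hf, (mul_smul g f c).symm ▸ rfl⟩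

end Hyperimaginary

section Sigma

variable {γ : Type u} (pE : Set (L.Formula (γ ⊕ γ))) (a : γ → M)
variable {V β : Type u} {pS : Set (L.Formula (V ⊕ β))} {bp : β → M}

/-- The solution set `Σ(𝔠)` of the partial type `Σ` (given by formulas `pS` over
the parameters `bp`). -/
abbrev Sol (pS : Set (L.Formula (V ⊕ β))) (bp : β → M) : Set (V → M) := SolSet pS bp

/-- The type of realizations of `Σ`. -/
abbrev SolT (pS : Set (L.Formula (V ⊕ β))) (bp : β → M) := ↥(Sol pS bp)

variable (pS bp) in
/-- The partial type `Σ` is `e`-invariant. -/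
def SolInv : Prop := ∀ (g : Ge pE a) (v : V → M), v ∈ Sol pS bp → g • v ∈ Sol pS bp

/-- The restriction homomorphism `Aut_e(𝔠) → Perm(Σ(𝔠))`, `f ↦ f ↾ Σ(𝔠)`. -/
def resPerm (hInv : SolInv pE a pS bp) : Ge pE a →* Equiv.Perm (SolT pS bp) where
  toFun g :=
    { toFun := fun v => ⟨g • (v : V → M), hInv g v v.2⟩
      invFun := fun v => ⟨g⁻¹ • (v : V → M), hInv g⁻¹ v v.2⟩
      left_inv := fun v => Subtype.ext (inv_smul_smul g (v : V → M))
      right_inv := fun v => Subtype.ext (smul_inv_smul g (v : V → M)) }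
  map_one' := Equiv.ext fun v => Subtype.ext (one_smul (Ge pE a) (v : V → M))
  map_mul' g h := Equiv.ext fun v => Subtype.ext (mul_smul g h (v : V → M))

/-- `Aut_e(Σ) = {f ↾ Σ(𝔠) : f ∈ Aut_e(𝔠)}`, as a subgroup of the permutations of
`Σ(𝔠)`. -/
def AutES (hInv : SolInv pE a pS bp) : Subgroup (Equiv.Perm (SolT pS bp)) :=
  (resPerm pE a hInv).range

/-- `Aut_e(Σ)` as a group. -/
abbrev GS (hInv : SolInv pE a pS bp) := ↥(AutES pE a hInv)

/-- The restriction map `ξ : Aut_e(𝔠) → Aut_e(Σ)`. -/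
def toGS (hInv : SolInv pE a pS bp) : Ge pE a →* GS pE a hInv :=
  (resPerm pE a hInv).rangeRestrict

/-- A tuple of realizations of `Σ`, flattened to a tuple of elements of `M`. -/
def flat {ι : Type u} (c : ι → SolT pS bp) : ι × V → M := fun p => (c p.1 : V → M) p.2

theorem flat_toGS_smul (hInv : SolInv pE a pS bp) {ι : Type u} (g : Ge pE a)
    (c : ι → SolT pS bp) : flat ((toGS pE a hInv g) • c) = g • flat c := rfl

theorem flat_smul_of_res (hInv : SolInv pE a pS bp) {ι : Type u} {τ : GS pE a hInv}
    {g : Ge pE a} (hg : resPerm pE a hInv g = ↑τ) (c : ι → SolT pS bp) :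
    flat (τ • c) = g • flat c := by
  have : τ = toGS pE a hInv g := Subtype.ext hg.symm
  subst this
  rfl

/-- `Autf_L(Σ, e)`: the subgroup of `Aut_e(Σ)` consisting of those restricted
automorphisms `σ` such that every small tuple of realizations of `Σ` has the same
Lascar strong type over `e` as its image under `σ`. -/
def AutfLS (hInv : SolInv pE a pS bp) : Subgroup (GS pE a hInv) where
  carrier := {σ | ∀ (ι : Type u), #ι < κ → ∀ c : ι → SolT pS bp,
      LEq κ pE a (flat c) (flat (σ • c))}
  one_mem' := by
    intro ι _ c
    rw [one_smul]
    exact LEq.refl κ pE a _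
  mul_mem' := by
    intro σ τ hσ hτ ι hι c
    rw [mul_smul]
    exact LEq.trans κ pE a (hτ ι hι c) (hσ ι hι (τ • c))
  inv_mem' := by
    intro σ hσ ι hι c
    have h := hσ ι hι (σ⁻¹ • c)
    rw [smul_inv_smul] at h
    exact LEq.symm κ pE a h

theorem AutfLS_normal (hInv : SolInv pE a pS bp) : (AutfLS κ pE a hInv).Normal := by
  constructor
  intro σ hσ τ ι hι c
  obtain ⟨g, hg⟩ := τ.2
  have hginv : resPerm pE a hInv g⁻¹ = ↑τ⁻¹ := by
    rw [map_inv, hg]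
    rfl
  obtain ⟨f, hf, hfe⟩ := hσ ι hι (τ⁻¹ • c)
  refine ⟨g * f * g⁻¹, (Subgroup.normalClosure_normal).conj_mem f hf g, ?_⟩
  have h1 : flat (τ⁻¹ • c) = g⁻¹ • flat c := flat_smul_of_res pE a hInv hginv c
  have h2 : flat ((τ * σ * τ⁻¹) • c) = g • flat (σ • τ⁻¹ • c) := by
    rw [mul_smul, mul_smul]
    exact flat_smul_of_res pE a hInv hg _
  rw [h2, ← hfe, h1, ← mul_smul, ← mul_smul]

/-- The relativized Lascar group `Gal_L(Σ, e) = Aut_e(Σ) / Autf_L(Σ, e)`. -/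
def GalL (hInv : SolInv pE a pS bp) := GS pE a hInv ⧸ AutfLS κ pE a hInv

/-- The projection `π_b : Aut_e(Σ) → Gal_L(Σ, e)`. -/
def projb (hInv : SolInv pE a pS bp) : GS pE a hInv → GalL κ pE a hInv :=
  QuotientGroup.mk

/-- The projection `π_Σ : Aut_e(𝔠) → Gal_L(Σ, e)`. -/
def projS (hInv : SolInv pE a pS bp) : Ge pE a → GalL κ pE a hInv :=
  fun g => projb κ pE a hInv (toGS pE a hInv g)

/-- A Lascar tuple in `Σ` over `e`: a small tuple `b` of realizations of `Σ` such
that `Autf_L(Σ, e) = {σ ∈ Aut_e(Σ) : b ≡ᴸ_e σ(b)}`. -/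
def IsLascarTuple (hInv : SolInv pE a pS bp) {ιb : Type u} (b : ιb → SolT pS bp) : Prop :=
  #ιb < κ ∧ ∀ σ : GS pE a hInv,
    σ ∈ AutfLS κ pE a hInv ↔ LEq κ pE a (flat b) (flat (σ • b))

variable (pS bp) in
/-- `e ∈ dcl(Σ)`: there is a small tuple of realizations of `Σ` over which `e` is
definable. -/
def eInDclSigma : Prop :=
  ∃ (ι : Type u) (c : ι → SolT pS bp), #ι < κ ∧ eInDclTuple pE a (flat c)

/-- The complete type of the tuple `v` over the parameters `prm` (with both
indexed by `ι`): the set of formulas realized by `v` with parameters `prm`. -/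
def tpOver {ι : Type u} (prm v : ι → M) : Set (L.Formula (ι ⊕ ι)) :=
  {φ | φ.Realize (Sum.elim v prm)}

/-- The type space `S_b(b) = {tp(f(b)/b) : f ∈ Aut_e(𝔠)}` over a tuple `b` of
realizations of `Σ`. -/
def Sb {ιb : Type u} (b : ιb → SolT pS bp) :
    Set (Set (L.Formula ((ιb × V) ⊕ (ιb × V)))) :=
  Set.range fun g : Ge pE a => tpOver (flat b) (g • flat b)

/-- The logic topology on a set of types: the subspace topology induced from the
product topology on `Formula → Bool` via characteristic functions. -/
noncomputable def typeSetTop {F : Type u} (X : Set (Set F)) : TopologicalSpace ↥X :=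
  TopologicalSpace.induced
    (fun p (φ : F) => (p : Set F).boolIndicator φ) inferInstance

/-- The map `ν_b : S_b(b) → Gal_L(Σ, e)`, `tp(σ(b)/b) ↦ [σ]`. -/
noncomputable def nub (hInv : SolInv pE a pS bp) {ιb : Type u} (b : ιb → SolT pS bp) :
    ↥(Sb pE a b) → GalL κ pE a hInv :=
  fun p => projS κ pE a hInv (Set.mem_range.mp p.2).choose

/-- The topology `𝔱_b` on the relativized Lascar group `Gal_L(Σ, e)`: the quotient
topology induced by `ν_b` from the logic topology on `S_b(b)`. -/
noncomputable def galTopb (hInv : SolInv pE a pS bp) {ιb : Type u}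
    (b : ιb → SolT pS bp) : TopologicalSpace (GalL κ pE a hInv) :=
  (typeSetTop (Sb pE a b)).coinduced (nub κ pE a hInv b)

end Sigma

section GalT

variable {γ : Type u} (pE : Set (L.Formula (γ ⊕ γ))) (a : γ → M)

/-- The Lascar group `Gal_L(T, e) = Aut_e(𝔠) / Autf_L(𝔠, e)`. -/
def GalT := Ge pE a ⧸ AutfL κ pE a

/-- The projection `π : Aut_e(𝔠) → Gal_L(T, e)`. -/
def projT : Ge pE a → GalT κ pE a := QuotientGroup.mk

/-- The type space `S_N(N) = {tp(f(N)/N) : f ∈ Aut_e(𝔠)}` over a small model `N`. -/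
def SMod (N : L.ElementarySubstructure M) : Set (Set (L.Formula (↥N ⊕ ↥N))) :=
  Set.range fun g : Ge pE a =>
    tpOver (Subtype.val : ↥N → M) (g • (Subtype.val : ↥N → M))

/-- The map `ν : S_N(N) → Gal_L(T, e)`, `tp(f(N)/N) ↦ [f]`. -/
noncomputable def nuT (N : L.ElementarySubstructure M) :
    ↥(SMod pE a N) → GalT κ pE a :=
  fun p => projT κ pE a (Set.mem_range.mp p.2).choose

/-- The standard quotient topology on the Lascar group `Gal_L(T, e)` induced via
the type space over a small model `N` (with `e ∈ dcl(N)`). -/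
noncomputable def galTopT (N : L.ElementarySubstructure M) :
    TopologicalSpace (GalT κ pE a) :=
  (typeSetTop (SMod pE a N)).coinduced (nuT κ pE a N)

/-- `Autf_KP(𝔠, e)`: the preimage under `π` of the closure of the identity in
`Gal_L(T, e)`. -/
noncomputable def AutfKPset (N : L.ElementarySubstructure M) : Set (Ge pE a) :=
  projT κ pE a ⁻¹' (@closure _ (galTopT κ pE a N) {projT κ pE a 1})

/-- `Autf_S(𝔠, e)`: the preimage under `π` of the connected component of the
identity in `Gal_L(T, e)`. -/
noncomputable def AutfSset (N : L.ElementarySubstructure M) : Set (Ge pE a) :=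
  projT κ pE a ⁻¹' (@connectedComponent _ (galTopT κ pE a N) (projT κ pE a 1))

/-- `c ≡ᴷᴾ_e d` : the tuples have the same KP strong type over `e`. -/
def KPeq (N : L.ElementarySubstructure M) {ι : Type u} (c d : ι → M) : Prop :=
  ∃ f ∈ AutfKPset κ pE a N, f • c = d

/-- `c ≡ˢ_e d` : the tuples have the same Shelah strong type over `e`. -/
def Seq (N : L.ElementarySubstructure M) {ι : Type u} (c d : ι → M) : Prop :=
  ∃ f ∈ AutfSset κ pE a N, f • c = d

end GalT

section Relativized

variable {γ : Type u} (pE : Set (L.Formula (γ ⊕ γ))) (a : γ → M)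
variable {V β : Type u} {pS : Set (L.Formula (V ⊕ β))} {bp : β → M}

/-- `Autf_KP(Σ, e)`: the set of restricted automorphisms fixing the KP strong
type of every small tuple of realizations of `Σ`. -/
noncomputable def AutfKPSset (hInv : SolInv pE a pS bp) (N : L.ElementarySubstructure M) :
    Set (GS pE a hInv) :=
  {σ | ∀ (ι : Type u), #ι < κ → ∀ c : ι → SolT pS bp,
      KPeq κ pE a N (flat c) (flat (σ • c))}

/-- `Autf_S(Σ, e)`: the set of restricted automorphisms fixing the Shelah strong
type of every small tuple of realizations of `Σ`. -/
noncomputable def AutfSSset (hInv : SolInv pE a pS bp) (N : L.ElementarySubstructure M) :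
    Set (GS pE a hInv) :=
  {σ | ∀ (ι : Type u), #ι < κ → ∀ c : ι → SolT pS bp,
      Seq κ pE a N (flat c) (flat (σ • c))}

/-- The orbit under `Aut_e(𝔠)` of the hyperimaginary given by the class of `x`
under the relation defined by `pF` is small ("`x_F` is bounded over `e`"). -/
def BoundedClass {δ : Type u} (pF : Set (L.Formula (δ ⊕ δ))) (x : δ → M) : Prop :=
  #↥(Set.range fun g : Ge pE a => g • Fclass pF x) < κ

/-- The orbit under `Aut_e(𝔠)` of the hyperimaginary given by the class of `x` is
finite ("`x_F` is algebraic over `e`"). -/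
def FiniteClass {δ : Type u} (pF : Set (L.Formula (δ ⊕ δ))) (x : δ → M) : Prop :=
  (Set.range fun g : Ge pE a => g • Fclass pF x).Finite

/-- `f` fixes the hyperimaginary given by the class of `x` (setwise). -/
def FixesClass (f : Ge pE a) {δ : Type u} (pF : Set (L.Formula (δ ⊕ δ)))
    (x : δ → M) : Prop :=
  f • Fclass pF x = Fclass pF x

variable (pS bp) in
/-- `f` fixes every hyperimaginary that is bounded over `e` and has a
representative which is a small tuple of realizations of `Σ`, i.e. `f` fixes
`bdd(e) ∩ Σ` pointwise. -/
def fixesAllBddS (f : Ge pE a) : Prop :=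
  ∀ (ι : Type u) (pF : Set (L.Formula ((ι × V) ⊕ (ι × V)))) (c : ι → SolT pS bp),
    #ι < κ → Equivalence (Frel (M := M) pF) → BoundedClass κ pE a pF (flat c) →
    FixesClass pE a f pF (flat c)

variable (pS bp) in
/-- `f` fixes every hyperimaginary that is algebraic over `e` and has a
representative which is a small tuple of realizations of `Σ`, i.e. `f` fixes
`acl(e) ∩ Σ` pointwise. -/
def fixesAllAclS (f : Ge pE a) : Prop :=
  ∀ (ι : Type u) (pF : Set (L.Formula ((ι × V) ⊕ (ι × V)))) (c : ι → SolT pS bp),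
    #ι < κ → Equivalence (Frel (M := M) pF) → FiniteClass pE a pF (flat c) →
    FixesClass pE a f pF (flat c)

end Relativized


section More

variable {γ : Type u} (pE : Set (L.Formula (γ ⊕ γ))) (a : γ → M)
variable {V β : Type u} {pS : Set (L.Formula (V ⊕ β))} {bp : β → M}

theorem mem_AutfLS_iff (hInv : SolInv pE a pS bp) {σ : GS pE a hInv} :
    σ ∈ AutfLS κ pE a hInv ↔ ∀ (ι : Type u), #ι < κ → ∀ c : ι → SolT pS bp,
      LEq κ pE a (flat c) (flat (σ • c)) := Iff.rfl

theorem toGS_mem_autfLS (hInv : SolInv pE a pS bp) {f : Ge pE a}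
    (hf : f ∈ AutfL κ pE a) : toGS pE a hInv f ∈ AutfLS κ pE a hInv :=
  (mem_AutfLS_iff κ pE a hInv).mpr
    (fun ι _ c => ⟨f, hf, (flat_toGS_smul pE a hInv f c).symm⟩)

instance AutfL_normal : (AutfL κ pE a).Normal :=
  Subgroup.normalClosure_normal

/-- The group structure of the relativized Lascar group `Gal_L(Σ, e)`. -/
noncomputable def galLGroup (hInv : SolInv pE a pS bp) : Group (GalL κ pE a hInv) :=
  @QuotientGroup.Quotient.group _ _ (AutfLS κ pE a hInv) (AutfLS_normal κ pE a hInv)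

/-- The natural projection `ξ_L : Gal_L(T, e) → Gal_L(Σ, e)`. -/
noncomputable def xiL (hInv : SolInv pE a pS bp) : GalT κ pE a → GalL κ pE a hInv :=
  haveI := AutfLS_normal κ pE a hInv
  ⇑(QuotientGroup.map (AutfL κ pE a) (AutfLS κ pE a hInv) (toGS pE a hInv)
    (fun _ hf => Subgroup.mem_comap.mpr (toGS_mem_autfLS κ pE a hInv hf)))

/-- The orbit equivalence relation `≡ᴴ` of a set `H` of restricted automorphisms,
on tuples of realizations of `Σ`. -/
def orbEq {hInv : SolInv pE a pS bp} (H : Set (GS pE a hInv)) {ι : Type u}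
    (c d : ι → SolT pS bp) : Prop :=
  ∃ h ∈ H, h • c = d

end More


section TopologicalQuotient

open Topology

/-- The identity component of a group carrying a topology for which left translations and
inversion are continuous. -/
def identityComponent {G : Type*} [Group G] [TopologicalSpace G]
    (hl : ∀ x : G, Continuous fun y => x⁻¹ * y) (hi : Continuous fun x : G => x⁻¹) :
    Subgroup G where
  carrier := connectedComponent 1
  one_mem' := mem_connectedComponent
  mul_mem' := by
    intro x y hx hy
    have h := (isPreconnected_connectedComponent (x := (1 : G))).image _ (hl x⁻¹).continuousOn
    rw [connectedComponent_eq hx]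
    refine h.subset_connectedComponent ⟨1, mem_connectedComponent, by simp⟩ ⟨y, hy, by simp⟩
  inv_mem' := by
    intro x hx
    have h := (isPreconnected_connectedComponent (x := (1 : G))).image _ hi.continuousOn
    exact h.subset_connectedComponent ⟨1, mem_connectedComponent, by simp⟩ ⟨x, hx, rfl⟩

theorem identityComponent_normal {G : Type*} [Group G] [TopologicalSpace G]
    (hl : ∀ x : G, Continuous fun y => x⁻¹ * y) (hi : Continuous fun x : G => x⁻¹) :
    (identityComponent hl hi).Normal := by
  constructor
  intro x hx g
  have hc : Continuous fun y : G => g * y * g⁻¹ := by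
    have := hi.comp ((hl g⁻¹).comp (hi.comp (hl g⁻¹)))
    convert this using 2
    simp [mul_assoc]
  have h := (isPreconnected_connectedComponent (x := (1 : G))).image _ hc.continuousOn
  exact h.subset_connectedComponent ⟨1, mem_connectedComponent, by simp⟩ ⟨x, hx, rfl⟩

/-- A quotient of a compact space by an equivalence relation which is closed in the product
is Hausdorff. -/
theorem t2Space_of_isQuotientMap_of_isClosed {X Y : Type*} [TopologicalSpace X] [CompactSpace X]
    [TopologicalSpace Y] {q : X → Y} (hq : IsQuotientMap q)
    (hR : IsClosed {p : X × X | q p.1 = q p.2}) : T2Space Y := by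
  have hcl : IsClosedMap q := by
    intro F hF
    rw [← hq.isClosed_preimage]
    have h := isClosedMap_snd_of_compactSpace _ (hR.inter (hF.preimage continuous_fst))
    convert h using 1
    ext y
    constructor
    · rintro ⟨x, hx, hxy⟩
      exact ⟨(x, y), ⟨hxy, hx⟩, rfl⟩
    · rintro ⟨⟨x, y'⟩, ⟨h1, h2⟩, rfl⟩
      exact ⟨x, h2, h1⟩
  have hfib : ∀ y : Y, IsCompact (q ⁻¹' {y}) := by
    intro y
    obtain ⟨x, rfl⟩ := hq.surjective y
    exact (hR.preimage (by fun_prop : Continuous fun z : X => (z, x))).isCompact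
  refine ⟨fun u v huv => ?_⟩
  obtain ⟨U, W, hU, hW, hAU, hBW, hUW⟩ := generalized_tube_lemma (hfib u) (hfib v) hR.isOpen_compl
    (by
      rintro ⟨x, y⟩ ⟨hx, hy⟩ h
      exact huv (hx.symm.trans (Eq.trans h hy)))
  refine ⟨(q '' Uᶜ)ᶜ, (q '' Wᶜ)ᶜ, (hcl _ hU.isClosed_compl).isOpen_compl,
    (hcl _ hW.isClosed_compl).isOpen_compl, ?_, ?_, ?_⟩
  · rintro ⟨x, hx, hxu⟩
    exact hx (hAU hxu)
  · rintro ⟨x, hx, hxu⟩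
    exact hx (hBW hxu)
  · rw [Set.disjoint_left]
    intro w hw1 hw2
    obtain ⟨x, rfl⟩ := hq.surjective w
    have h1 : x ∈ U := by
      by_contra h
      exact hw1 ⟨x, h, rfl⟩
    have h2 : x ∈ W := by
      by_contra h
      exact hw2 ⟨x, h, rfl⟩
    exact hUW (⟨h1, h2⟩ : (x, x) ∈ U ×ˢ W) rfl

/-- In a group which is a quotient of a compact space in such a way that division is continuous
on the square of that space, points outside the identity component are excluded by closed
subgroups of finite index. -/
theorem exists_isClosed_finiteIndex_of_notMem_connectedComponent {Γ G : Type*} [Group Γ] [Group G]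
    [TopologicalSpace Γ] [TopologicalSpace G] [CompactSpace Γ] (π : Γ →* G)
    (hπ : IsQuotientMap π) (hdiv : Continuous fun p : Γ × Γ => π (p.1⁻¹ * p.2)) {x : G}
    (hx : x ∉ connectedComponent (1 : G)) :
    ∃ H : Subgroup G, H.FiniteIndex ∧ IsClosed (H : Set G) ∧ x ∉ H := by
  have hl : ∀ x : G, Continuous fun y => x⁻¹ * y := by
    intro x
    obtain ⟨f, rfl⟩ := hπ.surjective x
    rw [hπ.continuous_iff]
    have := hdiv.comp (by fun_prop : Continuous fun g : Γ => (f, g))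
    simpa [Function.comp_def] using this
  have hi : Continuous fun x : G => x⁻¹ := by
    rw [hπ.continuous_iff]
    have := hdiv.comp (by fun_prop : Continuous fun g : Γ => (g, (1 : Γ)))
    simpa [Function.comp_def] using this
  let C := identityComponent hl hi
  have : C.Normal := identityComponent_normal hl hi
  have hCcl : IsClosed (C : Set G) := isClosed_connectedComponent
  have hp : IsQuotientMap (QuotientGroup.mk' C) := isQuotientMap_quotient_mk'
  have hq : IsQuotientMap ((QuotientGroup.mk' C) ∘ π) := hp.comp hπ
  have hqdiv : Continuous fun p : Γ × Γ => QuotientGroup.mk' C (π (p.1⁻¹ * p.2)) :=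
    hp.continuous.comp hdiv
  have : T2Space (G ⧸ C) := by
    refine t2Space_of_isQuotientMap_of_isClosed hq ?_
    convert hCcl.preimage hdiv using 1
    ext ⟨f, g⟩
    simp [QuotientGroup.eq]
  have : CompactSpace (G ⧸ C) := by
    have := isCompact_range hq.continuous
    rw [hq.surjective.range_eq] at this
    exact ⟨this⟩
  have hqq : IsQuotientMap (Prod.map ((QuotientGroup.mk' C) ∘ π) ((QuotientGroup.mk' C) ∘ π)) :=
    ((hq.continuous.prodMap hq.continuous).isClosedMap).isQuotientMap
      (hq.continuous.prodMap hq.continuous) (hq.surjective.prodMap hq.surjective)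
  have hPdiv : Continuous fun p : (G ⧸ C) × (G ⧸ C) => p.1⁻¹ * p.2 := by
    rw [hqq.continuous_iff]
    simpa [Function.comp_def] using hqdiv
  have hPinv : Continuous fun p : G ⧸ C => p⁻¹ := by
    simpa [Function.comp_def] using
      hPdiv.comp (by fun_prop : Continuous fun p : G ⧸ C => (p, (1 : G ⧸ C)))
  have : IsTopologicalGroup (G ⧸ C) :=
    { continuous_mul := by
        have := hPdiv.comp (hPinv.prodMap continuous_id)
        simpa [Function.comp_def] using this
      continuous_inv := hPinv }
  have hfib : ∀ t : G ⧸ C, IsConnected (QuotientGroup.mk' C ⁻¹' {t}) := by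
    intro t
    obtain ⟨g, rfl⟩ := hp.surjective t
    have h := (isConnected_connectedComponent (x := (1 : G))).image _ (hl g⁻¹).continuousOn
    convert h using 1
    ext y
    constructor
    · intro hy
      exact ⟨g⁻¹ * y, QuotientGroup.eq.1 (Eq.symm hy), by simp⟩
    · rintro ⟨z, hz, rfl⟩
      exact (QuotientGroup.eq.2 (show g⁻¹ * ((g⁻¹)⁻¹ * z) ∈ C by
        rw [inv_inv, inv_mul_cancel_left]; exact hz)).symm
  have : TotallyDisconnectedSpace (G ⧸ C) := by
    rw [totallyDisconnectedSpace_iff_connectedComponent_singleton]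
    intro t
    obtain ⟨g, rfl⟩ := hp.surjective t
    have hconn := hp.isCoinducing.isConnected_preimage_of_isClosed hfib
      (isClosed_connectedComponent (x := QuotientGroup.mk' C g)) isConnected_connectedComponent
    refine Set.Subset.antisymm ?_ (by simpa using mem_connectedComponent)
    intro s hs
    obtain ⟨y, rfl⟩ := hp.surjective s
    have hy := hconn.isPreconnected.subset_connectedComponent
      (x := g) (by exact mem_connectedComponent) hs
    have := ((isPreconnected_connectedComponent (x := g)).image _
      (hl g).continuousOn).subset_connectedComponent ⟨g, mem_connectedComponent, rfl⟩ ⟨y, hy, rfl⟩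
    simp only [inv_mul_cancel] at this
    exact (QuotientGroup.eq.2 this).symm
  have hx1 : QuotientGroup.mk' C x ≠ 1 := fun h => hx ((QuotientGroup.eq_one_iff x).1 h)
  obtain ⟨N, hN⟩ := ProfiniteGrp.exist_openNormalSubgroup_sub_open_nhds_of_one
    (isOpen_compl_singleton (x := QuotientGroup.mk' C x)) hx1.symm
  have : Finite ((G ⧸ C) ⧸ N.toSubgroup) := N.toSubgroup.quotient_finite_of_isOpen N.isOpen'
  have : N.toSubgroup.FiniteIndex := N.toSubgroup.finiteIndex_of_finite_quotient
  refine ⟨N.toSubgroup.comap (QuotientGroup.mk' C), ⟨?_⟩,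
    (N.toSubgroup.isClosed_of_isOpen N.isOpen').preimage hp.continuous, fun h => hN h rfl⟩
  rw [Subgroup.index_comap_of_surjective _ hp.surjective]
  exact Subgroup.FiniteIndex.index_ne_zero

end TopologicalQuotient

section Limits

open Filter

variable {δ : Type u}

theorem realize_smul (g : M ≃[L] M) (φ : L.Formula δ) (x : δ → M) :
    φ.Realize (g • x) ↔ φ.Realize x :=
  FirstOrder.Language.StrongHomClass.realize_formula g φ

theorem smul_sumElim {G : Type*} [SMul G M] {δ' : Type u} (g : G) (x : δ → M) (y : δ' → M) :
    g • Sum.elim x y = Sum.elim (g • x) (g • y) := by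
  ext (i | i) <;> rfl

/-- The type of the tuple `d` is the limit along `U` of the types of the tuples `v i`. -/
def IsTypeLimit (L : FirstOrder.Language.{u, u}) {M : Type u} [L.Structure M] {δ : Type u}
    {I : Type*} (U : Ultrafilter I) (v : I → δ → M) (d : δ → M) : Prop :=
  ∀ φ : L.Formula δ, φ.Realize d ↔ ∀ᶠ i in U, φ.Realize (v i)

variable {I : Type*} {U : Ultrafilter I} {v : I → δ → M} {d d' : δ → M}

theorem IsTypeLimit.comp (h : IsTypeLimit L U v d) {δ' : Type u} (ρ : δ' → δ) :
    IsTypeLimit L U (fun i => v i ∘ ρ) (d ∘ ρ) := by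
  intro φ
  simpa using h (φ.relabel ρ)

theorem IsTypeLimit.smul_left (h : IsTypeLimit L U v d) (g : I → (M ≃[L] M)) :
    IsTypeLimit L U (fun i => g i • v i) d := by
  intro φ
  simpa only [realize_smul] using h φ

theorem IsTypeLimit.smul_right (h : IsTypeLimit L U v d) (g : M ≃[L] M) :
    IsTypeLimit L U v (g • d) := by
  intro φ
  simpa only [realize_smul] using h φ

theorem IsTypeLimit.sameTp (h : IsTypeLimit L U v d) (h' : IsTypeLimit L U v d') :
    SameTp (L := L) d d' :=
  fun φ => (h φ).trans (h' φ).symm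

theorem IsTypeLimit.map {J : Type*} {w : J → δ → M} {m : I → J} :
    IsTypeLimit L (U.map m) w d ↔ IsTypeLimit L U (fun i => w (m i)) d := Iff.rfl

theorem isTypeLimit_const (d : δ → M) : IsTypeLimit L U (fun _ => d) d := by
  intro φ
  simp

theorem exists_ultrafilter_isTypeLimit (v : I → δ → M) (d : δ → M)
    (h : ∀ φ : L.Formula δ, φ.Realize d → ∃ i, φ.Realize (v i)) :
    ∃ U : Ultrafilter I, IsTypeLimit L U v d := by
  obtain ⟨U, hU⟩ := Ultrafilter.exists_ultrafilter_of_finite_inter_nonempty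
    {S : Set I | ∃ φ : L.Formula δ, φ.Realize d ∧ S = {i | φ.Realize (v i)}} (by
      intro T hT
      suffices ∃ φ : L.Formula δ, φ.Realize d ∧ {i | φ.Realize (v i)} ⊆ ⋂₀ (T : Set (Set I)) by
        obtain ⟨φ, hφ, hs⟩ := this
        exact (h φ hφ).imp fun i hi => hs hi
      classical
      induction T using Finset.induction_on with
      | empty => exact ⟨⊤, by simp, by simp⟩
      | insert S T _ ih =>
        rw [Finset.coe_insert, Set.insert_subset_iff] at hT
        obtain ⟨φ, hφ, hs⟩ := ih hT.2
        obtain ⟨ψ, hψ, rfl⟩ := hT.1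
        refine ⟨ψ ⊓ φ, by simp [hφ, hψ], ?_⟩
        rw [Finset.coe_insert, Set.sInter_insert]
        intro i hi
        rw [Set.mem_ofPred_eq, FirstOrder.Language.Formula.realize_inf] at hi
        exact ⟨hi.1, hs hi.2⟩)
  have key : ∀ φ : L.Formula δ, φ.Realize d → ∀ᶠ i in U, φ.Realize (v i) :=
    fun φ hφ => hU ⟨φ, hφ, rfl⟩
  refine ⟨U, fun φ => ⟨key φ, fun hφ => ?_⟩⟩
  by_contra hn
  have h2 := key φ.not (by simpa using hn)
  obtain ⟨i, h3, h4⟩ := (hφ.and h2).exists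
  exact (FirstOrder.Language.Formula.realize_not.1 h4) h3

theorem IsMonster.exists_isTypeLimit {κ : Cardinal.{u}} (hM : IsMonster κ L M) (U : Ultrafilter I)
    {π : Type u} (hδ : #δ < κ) (hπ : #π < κ) (v : I → δ → M) (prm : π → M) :
    ∃ d : δ → M, IsTypeLimit L U (fun i => Sum.elim (v i) prm) (Sum.elim d prm) := by
  obtain ⟨d, hd⟩ := hM.2.2 δ π prm
    {φ : L.Formula (δ ⊕ π) | ∀ᶠ i in U, φ.Realize (Sum.elim (v i) prm)} hδ hπ (by
      intro q hq
      have h : ∀ᶠ i in U, ∀ φ ∈ (q : Set (L.Formula (δ ⊕ π))), φ.Realize (Sum.elim (v i) prm) :=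
        (eventually_all_finite q.finite_toSet).2 fun φ hφ => hq hφ
      obtain ⟨i, hi⟩ := h.exists
      exact ⟨v i, hi⟩)
  refine ⟨d, fun φ => ⟨fun h => ?_, hd φ⟩⟩
  by_contra hn
  rw [← Ultrafilter.eventually_not] at hn
  have := hd φ.not (hn.mono fun i hi => FirstOrder.Language.Formula.realize_not.2 hi)
  exact FirstOrder.Language.Formula.realize_not.1 this h

theorem IsMonster.exists_smul_eq {κ : Cardinal.{u}} (hM : IsMonster κ L M) (hδ : #δ < κ)
    (h : SameTp (L := L) d d') : ∃ f : M ≃[L] M, f • d = d' := by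
  obtain ⟨f, hf⟩ := hM.2.1 δ d d' hδ h
  exact ⟨f, funext hf⟩

theorem IsMonster.add_lt {κ : Cardinal.{u}} (hM : IsMonster κ L M) {δ δ' : Type u} (h : #δ < κ)
    (h' : #δ' < κ) : #(δ ⊕ δ') < κ := by
  rw [mk_sum, lift_id, lift_id]
  exact add_lt_of_lt hM.1.le h h'

theorem IsMonster.prod_lt {κ : Cardinal.{u}} (hM : IsMonster κ L M) {δ δ' : Type u} (h : #δ < κ)
    (h' : #δ' < κ) : #(δ × δ') < κ := by
  rw [mk_prod, lift_id, lift_id]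
  exact mul_lt_of_lt hM.1.le h h'

variable {pF : Set (L.Formula (δ ⊕ δ))}

theorem Frel.of_sameTp {x y x' y' : δ → M} (h : Frel pF x y)
    (hs : SameTp (L := L) (Sum.elim x y) (Sum.elim x' y')) : Frel pF x' y' :=
  fun φ hφ => (hs φ).1 (h φ hφ)

theorem Frel.of_isTypeLimit {w : I → δ → M} (hv : ∀ᶠ i in U, Frel pF (v i) (w i))
    (h : IsTypeLimit L U (fun i => Sum.elim (v i) (w i)) (Sum.elim d d')) : Frel pF d d' :=
  fun φ hφ => (h φ).2 (hv.mono fun _ hi => hi φ hφ)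

theorem frel_smul (g : M ≃[L] M) {x y : δ → M} : Frel pF (g • x) (g • y) ↔ Frel pF x y := by
  unfold Frel
  simp only [← smul_sumElim, realize_smul]

theorem smul_Fclass (g : M ≃[L] M) (x : δ → M) : g • Fclass pF x = Fclass pF (g • x) := by
  ext y
  rw [Set.mem_smul_set_iff_inv_smul_mem]
  change Frel pF x (g⁻¹ • y) ↔ Frel pF (g • x) y
  rw [← frel_smul g, smul_inv_smul]

theorem Fclass_eq_iff (hF : Equivalence (Frel (M := M) pF)) {x y : δ → M} :
    Fclass pF x = Fclass pF y ↔ Frel pF x y := by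
  constructor
  · intro h
    have : y ∈ Fclass pF x := h ▸ hF.refl y
    exact this
  · intro h
    ext z
    exact ⟨fun hz => hF.trans (hF.symm h) hz, fun hz => hF.trans h hz⟩

/-- Types over an elementary substructure are finitely satisfiable in it. -/
theorem exists_realize_of_elementarySubstructure (N : L.ElementarySubstructure M)
    (φ : L.Formula (δ ⊕ N)) {c : δ → M} (h : φ.Realize (Sum.elim c (Subtype.val : N → M))) :
    ∃ n : δ → N, φ.Realize (Sum.elim (fun i => (n i : M)) (Subtype.val : N → M)) := by
  classical
  have hne : Nonempty δ → Nonempty N := by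
    rintro ⟨i⟩
    by_contra hN
    rw [not_nonempty_iff] at hN
    let χ : L.Sentence := (⊥ : L.BoundedFormula Empty 1).all
    have h2 : (N : Type u) ⊨ χ ↔ M ⊨ χ := N.realize_sentence χ
    have h3 : (N : Type u) ⊨ χ := fun x => (hN.false x).elim
    exact (h2.1 h3) (c i)
  let s := φ.freeVarFinset
  let ψ : L.Formula (N ⊕ s) := φ.restrictFreeVar fun z =>
    match z with
    | ⟨Sum.inl i, hi⟩ => Sum.inr ⟨Sum.inl i, hi⟩
    | ⟨Sum.inr n, _⟩ => Sum.inl n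
  have hMex : (ψ.iExs s).Realize (Subtype.val : N → M) := by
    rw [FirstOrder.Language.Formula.realize_iExs]
    refine ⟨fun z => Sum.elim c (Subtype.val : N → M) z, ?_⟩
    exact (FirstOrder.Language.BoundedFormula.realize_restrictFreeVar
      (Sum.elim c (Subtype.val : N → M)) (by rintro ⟨i | n, hi⟩ <;> rfl)).2 h
  have hNex : (ψ.iExs s).Realize (id : N → N) :=
    (N.subtype.map_formula (ψ.iExs s) id).1 hMex
  rw [FirstOrder.Language.Formula.realize_iExs] at hNex
  obtain ⟨w, hw⟩ := hNex
  refine ⟨fun i => if hi : Sum.inl i ∈ s then w ⟨_, hi⟩ else (hne ⟨i⟩).some, ?_⟩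
  have hw' := (N.subtype.map_formula ψ (Sum.elim id w)).2 hw
  refine (FirstOrder.Language.BoundedFormula.realize_restrictFreeVar _ ?_).1 hw'
  rintro ⟨i | n, hi⟩
  · have hi' : Sum.inl i ∈ s := hi
    simp [hi']
  · rfl

end Limits

section Topology

open Filter Topology

variable {κ : Cardinal.{u}} {γ : Type u} {pE : Set (L.Formula (γ ⊕ γ))} {a : γ → M}
variable {τ δ : Type u} {t : τ → M}

theorem ge_smul_def (g : Ge pE a) (x : δ → M) : g • x = (g : M ≃[L] M) • x := rfl

theorem smul_Fclass_ge (pF : Set (L.Formula (δ ⊕ δ))) (g : Ge pE a) (x : δ → M) :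
    g • Fclass pF x = Fclass pF (g • x) :=
  smul_Fclass (g : M ≃[L] M) x

variable (pE a) in
/-- The topology on `Aut_e(𝔠)` induced by `f ↦ tp(f(t)/t)`. -/
noncomputable abbrev typeTop (t : τ → M) : TopologicalSpace (Ge pE a) :=
  TopologicalSpace.induced
    (fun g (φ : L.Formula (τ ⊕ τ)) => (tpOver t (g • t)).boolIndicator φ) inferInstance

theorem le_nhds_typeTop_iff (U : Ultrafilter (Ge pE a)) (f : Ge pE a) :
    ↑U ≤ @nhds _ (typeTop pE a t) f ↔
      IsTypeLimit L U (fun g => Sum.elim (g • t) t) (Sum.elim (f • t) t) := by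
  let _ := typeTop pE a t
  rw [nhds_induced, ← tendsto_iff_comap, tendsto_pi_nhds]
  refine forall_congr' fun φ => ?_
  rw [nhds_discrete, tendsto_pure]
  by_cases h : φ.Realize (Sum.elim (f • t) t)
  · have h1 : (tpOver t (f • t)).boolIndicator φ = true := (Set.mem_iff_boolIndicator _ _).1 h
    simp only [h1, h, true_iff]
    exact eventually_congr (Eventually.of_forall fun g => (Set.mem_iff_boolIndicator _ _).symm)
  · have h1 : (tpOver t (f • t)).boolIndicator φ = false := (Set.notMem_iff_boolIndicator _ _).1 h
    simp only [h1, h, false_iff]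
    rw [← Ultrafilter.eventually_not]
    exact eventually_congr (Eventually.of_forall fun g => (Set.notMem_iff_boolIndicator _ _).symm)

theorem compactSpace_typeTop (hM : IsMonster κ L M) (hE : Equivalence (Frel (M := M) pE))
    (hγ : #γ < κ) (hτ : #τ < κ) : @CompactSpace _ (typeTop pE a t) := by
  let _ := typeTop pE a t
  refine ⟨isCompact_iff_ultrafilter_le_nhds.2 fun U _ => ?_⟩
  obtain ⟨d, hd⟩ := hM.exists_isTypeLimit U (hM.add_lt hτ hγ) (hM.add_lt hτ hγ)
    (fun g => g • Sum.elim t a) (Sum.elim t a)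
  have h1 : IsTypeLimit L U (fun g : Ge pE a => g • Sum.elim t a) d := hd.comp Sum.inl
  have h2 : IsTypeLimit L U (fun g : Ge pE a => g • Sum.elim t a) (Sum.elim t a) :=
    (isTypeLimit_const (Sum.elim t a)).smul_left
      fun g : Ge pE a => (g : M ≃[L] M)
  obtain ⟨f, rfl⟩ := hM.exists_smul_eq (hM.add_lt hτ hγ) (h2.sameTp h1)
  have hfa : Frel pE a (f • a) := by
    refine Frel.of_isTypeLimit (U := U) (v := fun _ => a) (w := fun g => g • a) ?_ ?_
    · refine Eventually.of_forall fun g => (Fclass_eq_iff hE).1 ?_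
      rw [← smul_Fclass_ge]
      exact g.2.symm
    · convert hd.comp (Sum.elim (Sum.inr ∘ Sum.inr) (Sum.inl ∘ Sum.inr)) using 1
      · ext g (i | i) <;> rfl
      · ext (i | i) <;> rfl
  have hf : f ∈ AutE pE a := by
    change f • Fclass pE a = Fclass pE a
    rw [smul_Fclass]
    exact ((Fclass_eq_iff hE).2 hfa).symm
  refine ⟨⟨f, hf⟩, Set.mem_univ _, (le_nhds_typeTop_iff _ _).2 ?_⟩
  convert hd.comp (Sum.map Sum.inl Sum.inl) using 1
  · ext g (i | i) <;> rfl
  · ext (i | i) <;> rfl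

variable {G : Type*} [Group G] (π : Ge pE a →* G)

theorem isClosed_div_preimage (hM : IsMonster κ L M) (hτ : #τ < κ) (ht : eInDclTuple pE a t)
    (hπ : ∀ s : Ge pE a, s • t = t → π s = 1) {C : Set G}
    (hC : IsClosed[typeTop pE a t] (π ⁻¹' C)) :
    letI := typeTop pE a t
    IsClosed ((fun p : Ge pE a × Ge pE a => π (p.1⁻¹ * p.2)) ⁻¹' C) := by
  let _ := typeTop pE a t
  have hfix : ∀ s : M ≃[L] M, s • t = t → s ∈ AutE pE a := fun s hs => ht s (congrFun hs)
  rw [isClosed_iff_ultrafilter]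
  rintro ⟨f, g⟩ U hU hUC
  rw [nhds_prod_eq, le_prod] at hU
  obtain ⟨d, hd⟩ := hM.exists_isTypeLimit U (hM.add_lt hτ hτ) hτ
    (fun p => Sum.elim (p.1 • t) (p.2 • t)) t
  have h1 := (le_nhds_typeTop_iff (U.map Prod.fst) f).1 hU.1
  have h2 := (le_nhds_typeTop_iff (U.map Prod.snd) g).1 hU.2
  rw [IsTypeLimit.map] at h1 h2
  have h1' := hd.comp (Sum.map Sum.inl id)
  have h2' := hd.comp (Sum.map Sum.inr id)
  simp only [Sum.elim_comp_map, Sum.elim_comp_inl, Sum.elim_comp_inr, Function.comp_id] at h1' h2'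
  obtain ⟨h, hh⟩ := hM.exists_smul_eq (hM.add_lt hτ hτ) (h1.sameTp h1')
  obtain ⟨k, hk⟩ := hM.exists_smul_eq (hM.add_lt hτ hτ) (h2.sameTp h2')
  rw [smul_sumElim, Sum.elim_eq_iff] at hh hk
  let h₀ : Ge pE a := ⟨h, hfix h hh.2⟩
  let k₀ : Ge pE a := ⟨k, hfix k hk.2⟩
  have hw : π ((h₀ * f)⁻¹ * (k₀ * g)) = π (f⁻¹ * g) := by
    have e1 : π h₀ = 1 := hπ _ hh.2
    have e2 : π k₀ = 1 := hπ _ hk.2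
    simp [e1, e2]
  change π (f⁻¹ * g) ∈ C
  rw [← hw]
  refine isClosed_iff_ultrafilter.1 hC _ (U.map fun p : Ge pE a × Ge pE a => p.1⁻¹ * p.2) ?_ hUC
  rw [le_nhds_typeTop_iff, IsTypeLimit.map]
  have h3 := hd.comp (Sum.elim (Sum.inl ∘ Sum.inr) (Sum.inl ∘ Sum.inl))
  have h4 := (h3.smul_left fun p => ((p.1⁻¹ : Ge pE a) : M ≃[L] M)).smul_right
    (((h₀ * f)⁻¹ : Ge pE a) : M ≃[L] M)
  convert h4 using 1
  · ext p (i | i)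
    · exact congrFun (mul_smul p.1⁻¹ p.2 t) i
    · exact congrFun (inv_smul_smul p.1 t).symm i
  · have e1 : d ∘ Sum.inl = (h₀ * f) • t := hh.1.symm.trans (mul_smul h₀ f t).symm
    have e2 : d ∘ Sum.inr = (k₀ * g) • t := hk.1.symm.trans (mul_smul k₀ g t).symm
    have e3 : Sum.elim d t ∘ Sum.elim (Sum.inl ∘ Sum.inr) (Sum.inl ∘ Sum.inl) =
        Sum.elim ((k₀ * g) • t) ((h₀ * f) • t) := by
      rw [← e1, ← e2]
      ext (i | i) <;> rfl
    rw [e3, smul_sumElim]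
    ext (i | i)
    · exact congrFun (mul_smul (h₀ * f)⁻¹ (k₀ * g) t) i
    · exact congrFun (inv_smul_smul (h₀ * f) t).symm i

theorem isClosed_setOf_smul_mem_Fclass (hM : IsMonster κ L M) (hτ : #τ < κ) (hδ : #δ < κ)
    (ht : eInDclTuple pE a t) (hπ : ∀ s : Ge pE a, s • t = t → π s = 1)
    {pF : Set (L.Formula (δ ⊕ δ))} {c c' : δ → M}
    (hX : ∀ f g : Ge pE a, π f = π g → Frel pF c' (f • c) → Frel pF c' (g • c)) :
    IsClosed[typeTop pE a t] {f : Ge pE a | Frel pF c' (f • c)} := by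
  let _ := typeTop pE a t
  have hfix : ∀ s : M ≃[L] M, s • t = t → s ∈ AutE pE a := fun s hs => ht s (congrFun hs)
  rw [isClosed_iff_ultrafilter]
  intro f U hU hUX
  obtain ⟨d, hd⟩ := hM.exists_isTypeLimit U (hM.add_lt hτ hδ) (hM.add_lt hτ hδ)
    (fun g => g • Sum.elim t c) (Sum.elim t c')
  have h1 := (le_nhds_typeTop_iff U f).1 hU
  have h1' := hd.comp (Sum.map Sum.inl Sum.inl)
  simp only [Sum.elim_comp_map, Sum.elim_comp_inl, smul_sumElim] at h1'
  obtain ⟨h, hh⟩ := hM.exists_smul_eq (hM.add_lt hτ hτ) (h1.sameTp h1')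
  rw [smul_sumElim, Sum.elim_eq_iff] at hh
  have h2 : IsTypeLimit L U (fun g : Ge pE a => g • Sum.elim t c) (Sum.elim t c) :=
    (isTypeLimit_const (Sum.elim t c)).smul_left
      fun g : Ge pE a => (g : M ≃[L] M)
  have hd' : IsTypeLimit L U (fun g : Ge pE a => g • Sum.elim t c) d := hd.comp Sum.inl
  obtain ⟨k, rfl⟩ := hM.exists_smul_eq (hM.add_lt hτ hδ) (h2.sameTp hd')
  let h₀ : Ge pE a := ⟨h, hfix h hh.2⟩
  have hs : ((h₀ * f : Ge pE a) : M ≃[L] M)⁻¹ • k • t = t := by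
    have e : k • t = (h₀ * f) • t := hh.1.symm.trans (mul_smul h₀ f t).symm
    rw [e]
    exact inv_smul_smul (h₀ * f) t
  rw [← mul_smul] at hs
  let s₀ : Ge pE a := ⟨_, hfix _ hs⟩
  have hk : ((h₀ * f * s₀ : Ge pE a) : M ≃[L] M) = k := mul_inv_cancel_left _ k
  refine hX (h₀ * f * s₀) f ?_ ?_
  · have e1 : π h₀ = 1 := hπ _ hh.2
    have e2 : π s₀ = 1 := hπ _ hs
    simp [e1, e2]
  · rw [ge_smul_def, hk]
    refine Frel.of_isTypeLimit (U := U) (v := fun _ => c') (w := fun g => g • c) hUX ?_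
    convert hd.comp (Sum.elim (Sum.inr ∘ Sum.inr) (Sum.inl ∘ Sum.inr)) using 1
    · ext g (i | i) <;> rfl
    · ext (i | i) <;> rfl

/-- A closed subgroup of `Aut_e(𝔠)` containing the pointwise stabilizer of `t` is the setwise
stabilizer of the class of `t` under a type-definable equivalence relation. -/
theorem exists_equivalence_of_isClosed (hM : IsMonster κ L M)
    (hE : Equivalence (Frel (M := M) pE)) (hγ : #γ < κ) (hτ : #τ < κ) (ht : eInDclTuple pE a t)
    {H : Subgroup (Ge pE a)} (hH : IsClosed[typeTop pE a t] (H : Set (Ge pE a)))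
    (htH : ∀ s : Ge pE a, s • t = t → s ∈ H) :
    ∃ pF : Set (L.Formula (τ ⊕ τ)), Equivalence (Frel (M := M) pF) ∧
      ∀ f : Ge pE a, f • Fclass pF t = Fclass pF t ↔ f ∈ H := by
  let _ := typeTop pE a t
  have hfix : ∀ s : M ≃[L] M, s • t = t → s ∈ AutE pE a := fun s hs => ht s (congrFun hs)
  let pF : Set (L.Formula (τ ⊕ τ)) := {ψ | ∃ (φ : L.Formula (τ ⊕ τ)) (i : τ),
    (∀ h ∈ H, φ.Realize (Sum.elim t (h • t))) ∧
    ψ = φ ⊔ FirstOrder.Language.Term.equal (FirstOrder.Language.Term.var (Sum.inl i))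
      (FirstOrder.Language.Term.var (Sum.inr i))}
  have key : ∀ x y : τ → M, Frel pF x y ↔
      x = y ∨ ∃ k : M ≃[L] M, ∃ h ∈ H, k • t = x ∧ k • h • t = y := by
    intro x y
    constructor
    · intro hxy
      by_cases hne : x = y
      · exact Or.inl hne
      obtain ⟨i, hi⟩ := Function.ne_iff.1 hne
      obtain ⟨U, hU⟩ := exists_ultrafilter_isTypeLimit (L := L)
        (fun h : H => Sum.elim t ((h : Ge pE a) • t)) (Sum.elim x y) (by
          intro φ hφ
          by_contra! hn
          have := hxy _ ⟨φ.not, i, fun h hh => hn ⟨h, hh⟩, rfl⟩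
          simp [hφ, hi] at this)
      have hcpt := compactSpace_typeTop (a := a) (t := t) hM hE hγ hτ
      obtain ⟨h, -, hh⟩ := isCompact_iff_ultrafilter_le_nhds.1 isCompact_univ
        (U.map (Subtype.val : H → Ge pE a)) (by simp)
      have hhH : h ∈ H := isClosed_iff_ultrafilter.1 hH h _ hh
        (Ultrafilter.mem_map.2 (Eventually.of_forall (f := (U : Filter H)) fun g => g.2))
      rw [le_nhds_typeTop_iff, IsTypeLimit.map] at hh
      have h1 := hh.comp Sum.swap
      have e : ∀ g : Ge pE a, Sum.elim (g • t) t ∘ Sum.swap = Sum.elim t (g • t) := by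
        intro g
        ext (i | i) <;> rfl
      simp only [e] at h1
      obtain ⟨k, hk⟩ := hM.exists_smul_eq (hM.add_lt hτ hτ) (h1.sameTp hU)
      rw [smul_sumElim, Sum.elim_eq_iff] at hk
      exact Or.inr ⟨k, h, hhH, hk⟩
    · rintro (rfl | ⟨k, h, hh, rfl, rfl⟩)
      · rintro _ ⟨φ, i, -, rfl⟩
        simp
      · rintro _ ⟨φ, i, hφ, rfl⟩
        rw [FirstOrder.Language.Formula.realize_sup]
        refine Or.inl ?_
        rw [← smul_sumElim, realize_smul]
        exact hφ h hh
  have hF : Equivalence (Frel (M := M) pF) := by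
    refine ⟨fun x => (key _ _).2 (Or.inl rfl), ?_, ?_⟩
    · intro x y hxy
      rw [key] at hxy ⊢
      obtain rfl | ⟨k, h, hh, rfl, rfl⟩ := hxy
      · exact Or.inl rfl
      · refine Or.inr ⟨k * h, h⁻¹, inv_mem hh, mul_smul _ _ _, ?_⟩
        rw [mul_smul]
        exact congrArg (k • ·) (smul_inv_smul h t)
    · intro x y z hxy hyz
      rw [key] at hxy hyz ⊢
      obtain rfl | ⟨k, h, hh, rfl, rfl⟩ := hxy
      · exact hyz
      obtain rfl | ⟨k', h', hh', hkk, rfl⟩ := hyz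
      · exact Or.inr ⟨k, h, hh, rfl, rfl⟩
      have hs : (k * (h : M ≃[L] M))⁻¹ • k' • t = t := by
        rw [hkk, inv_smul_eq_iff, mul_smul]
        rfl
      rw [← mul_smul] at hs
      let s : Ge pE a := ⟨_, hfix _ hs⟩
      refine Or.inr ⟨k, h * s * h', mul_mem (mul_mem hh (htH s hs)) hh', rfl, ?_⟩
      have hk' : k * ((h * s : Ge pE a) : M ≃[L] M) = k' := by
        change k * ((h : M ≃[L] M) * ((k * (h : M ≃[L] M))⁻¹ * k')) = k'
        group
      rw [mul_smul, ← hk', mul_smul]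
      rfl
  refine ⟨pF, hF, fun f => ?_⟩
  rw [smul_Fclass_ge, eq_comm, Fclass_eq_iff hF, key]
  constructor
  · rintro (h | ⟨k, h, hh, hk, hkf⟩)
    · exact htH f h.symm
    · let k₀ : Ge pE a := ⟨k, hfix k hk⟩
      have h1 : k₀ • h • t = f • t := hkf
      have h2 : ((k₀ * h)⁻¹ * f) ∈ H := htH _ (by
        rw [mul_smul, ← h1, ← mul_smul k₀, inv_smul_smul])
      have h3 := mul_mem (mul_mem (htH k₀ hk) hh) h2
      rwa [mul_inv_cancel_left] at h3
  · intro hf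
    exact Or.inr ⟨1, f, hf, one_smul _ _, one_smul _ _⟩

end Topology

section Lascar

open Filter Topology

variable {κ : Cardinal.{u}} {γ : Type u} {pE : Set (L.Formula (γ ⊕ γ))} {a : γ → M}

/-- An automorphism fixing a small model over which `e` is definable fixes all classes which are
algebraic over `e`. -/
theorem frel_smul_of_mem_modelFixers (hM : IsMonster κ L M) {δ : Type u} (hδ : #δ < κ)
    {pF : Set (L.Formula (δ ⊕ δ))} (hF : Equivalence (Frel (M := M) pF)) {c : δ → M}
    (hc : FiniteClass pE a pF c) {f : Ge pE a} (hf : f ∈ modelFixers κ pE a) :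
    Frel pF c (f • c) := by
  classical
  obtain ⟨N, hN, hNe, hfN⟩ := hf
  let m : N → M := Subtype.val
  let O := Set.range fun g : Ge pE a => g • Fclass pF c
  have hrep : ∀ o : O, ∃ h : M ≃[L] M, h • m = m ∧
      ((∃ k : M ≃[L] M, k • m = m ∧ k • Fclass pF c = o) → h • Fclass pF c = o) := by
    intro o
    by_cases h : ∃ k : M ≃[L] M, k • m = m ∧ k • Fclass pF c = o
    · obtain ⟨k, hk, hko⟩ := h
      exact ⟨k, hk, fun _ => hko⟩
    · exact ⟨1, one_smul _ _, fun h' => absurd h' h⟩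
  choose rep hrepm hrep using hrep
  obtain ⟨U, hU⟩ := exists_ultrafilter_isTypeLimit (L := L)
    (fun n : δ → N => Sum.elim (m ∘ n) m) (Sum.elim c m)
    fun φ hφ => exists_realize_of_elementarySubstructure N φ hφ
  have hO : #O < κ := (lt_aleph0_iff_set_finite.2 hc).trans hM.1
  let r : O × δ → M := fun p => (rep p.1 • c) p.2
  obtain ⟨d, hd⟩ := hM.exists_isTypeLimit U hδ
    (hM.add_lt hN (hM.add_lt (hM.prod_lt hO hδ) (hM.add_lt hδ hδ)))
    (fun n => m ∘ n) (Sum.elim m (Sum.elim r (Sum.elim c (f • c))))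
  have hdm : IsTypeLimit L U (fun n : δ → N => Sum.elim (m ∘ n) m) (Sum.elim d m) := by
    convert hd.comp (Sum.map id Sum.inl) using 1
    · ext g (i | i) <;> rfl
    · ext (i | i) <;> rfl
  have hdc : IsTypeLimit L U (fun n : δ → N => Sum.elim (m ∘ n) c) (Sum.elim d c) := by
    convert hd.comp (Sum.map id (Sum.inr ∘ Sum.inr ∘ Sum.inl)) using 1
    · ext g (i | i) <;> rfl
    · ext (i | i) <;> rfl
  have hdf : IsTypeLimit L U (fun n : δ → N => Sum.elim (m ∘ n) (f • c)) (Sum.elim d (f • c)) := by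
    convert hd.comp (Sum.map id (Sum.inr ∘ Sum.inr ∘ Sum.inr)) using 1
    · ext g (i | i) <;> rfl
    · ext (i | i) <;> rfl
  obtain ⟨g, hg⟩ := hM.exists_smul_eq (hM.add_lt hδ hN) (hU.sameTp hdm)
  rw [smul_sumElim, Sum.elim_eq_iff] at hg
  obtain ⟨rfl, hgm⟩ := hg
  have hge : g ∈ AutE pE a := hNe g fun x hx => congrFun hgm ⟨x, hx⟩
  let o : O := ⟨g • Fclass pF c, ⟨g, hge⟩, rfl⟩
  have ho : rep o • Fclass pF c = g • Fclass pF c := hrep o ⟨g, hgm, rfl⟩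
  have hdo : IsTypeLimit L U (fun n : δ → N => Sum.elim (m ∘ n) (rep o • c))
      (Sum.elim (g • c) (rep o • c)) := by
    convert hd.comp (Sum.map id (Sum.inr ∘ Sum.inl ∘ Prod.mk o)) using 1
    · ext g (i | i) <;> rfl
    · ext (i | i) <;> rfl
  -- types of the form `tp(x, d)` depend only on the type of `x` over `N`
  have move : ∀ (k : M ≃[L] M), k • m = m →
      IsTypeLimit L U (fun n : δ → N => Sum.elim (m ∘ n) (k • c)) (Sum.elim (g • c) (k • c)) →
      SameTp (L := L) (Sum.elim (g • c) c) (Sum.elim (g • c) (k • c)) := by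
    intro k hk h
    refine hdc.sameTp ?_
    convert h.smul_left (fun _ => k⁻¹) using 1
    ext n (i | i)
    · have : k⁻¹ • m = m := by rw [inv_smul_eq_iff, hk]
      exact (congrFun this (n i)).symm
    · exact (congrFun (inv_smul_smul k c) i).symm
  have h1 : Frel pF (g • c) (rep o • c) := by
    rw [← Fclass_eq_iff hF, ← smul_Fclass, ← smul_Fclass, ho]
  have h2 : Frel pF (g • c) c := h1.of_sameTp fun φ => (move _ (hrepm o) hdo φ).symm
  have h3 : Frel pF (g • c) (f • c) :=
    h2.of_sameTp (move f (funext fun n => hfN n n.2) hdf)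
  exact hF.trans (hF.symm h2) h3

theorem smul_Fclass_of_mem_AutfL (hM : IsMonster κ L M) {δ : Type u} (hδ : #δ < κ)
    {pF : Set (L.Formula (δ ⊕ δ))} (hF : Equivalence (Frel (M := M) pF)) {c : δ → M}
    (hc : FiniteClass pE a pF c) {f : Ge pE a} (hf : f ∈ AutfL κ pE a) :
    f • Fclass pF c = Fclass pF c := by
  let X := MulAction.orbit (Ge pE a) (Fclass pF c)
  have hle : AutfL κ pE a ≤ (MulAction.toPermHom (Ge pE a) X).ker := by
    refine Subgroup.normalClosure_le_normal fun f hf => ?_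
    refine MonoidHom.mem_ker.2 (Equiv.ext ?_)
    rintro ⟨_, g, rfl⟩
    refine Subtype.ext ?_
    change f • g • Fclass pF c = g • Fclass pF c
    have hgc : FiniteClass pE a pF (g • c) := by
      refine hc.subset ?_
      rintro _ ⟨k, rfl⟩
      refine ⟨k * g, ?_⟩
      change (k * g) • Fclass pF c = k • Fclass pF (g • c)
      rw [mul_smul, smul_Fclass_ge pF g]
    rw [smul_Fclass_ge pF g, smul_Fclass_ge pF f, eq_comm, Fclass_eq_iff hF]
    exact frel_smul_of_mem_modelFixers hM hδ hF hgc hf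
  have h := Equiv.congr_fun (MonoidHom.mem_ker.1 (hle hf)) ⟨_, MulAction.mem_orbit_self _⟩
  exact congrArg Subtype.val h

end Lascar

section LascarQuotient

open Filter Topology

variable {κ : Cardinal.{u}} {γ : Type u} {pE : Set (L.Formula (γ ⊕ γ))} {a : γ → M}
variable {V β : Type u} {pS : Set (L.Formula (V ⊕ β))} {bp : β → M}

variable (κ) in
/-- The projection `π_Σ` as a group homomorphism. -/
noncomputable def projHom (hInv : SolInv pE a pS bp) :
    letI := galLGroup κ pE a hInv
    Ge pE a →* GalL κ pE a hInv :=
  haveI := AutfLS_normal κ pE a hInv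
  (QuotientGroup.mk' (AutfLS κ pE a hInv)).comp (toGS pE a hInv)

theorem projS_surjective (hInv : SolInv pE a pS bp) :
    Function.Surjective (projS κ pE a hInv) :=
  (QuotientGroup.mk_surjective (s := AutfLS κ pE a hInv)).comp
    (resPerm pE a hInv).rangeRestrict_surjective

theorem projS_eq_iff (hInv : SolInv pE a pS bp) {f g : Ge pE a} :
    projS κ pE a hInv f = projS κ pE a hInv g ↔
      toGS pE a hInv (f⁻¹ * g) ∈ AutfLS κ pE a hInv := by
  rw [map_mul, map_inv]
  exact QuotientGroup.eq

theorem projS_eq_one (hInv : SolInv pE a pS bp) {ιb : Type u} {b : ιb → SolT pS bp}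
    (hb : IsLascarTuple κ pE a hInv b) {s : Ge pE a} (hs : s • flat b = flat b) :
    projS κ pE a hInv s = projS κ pE a hInv 1 := by
  rw [eq_comm, projS_eq_iff, inv_one, one_mul, hb.2, flat_toGS_smul, hs]
  exact LEq.refl κ pE a _

theorem galTopb_eq_coinduced (hM : IsMonster κ L M) (hV : #V < κ) (hInv : SolInv pE a pS bp)
    {ιb : Type u} {b : ιb → SolT pS bp} (hb : IsLascarTuple κ pE a hInv b)
    (hbdcl : eInDclTuple pE a (flat b)) :
    galTopb κ pE a hInv b = (typeTop pE a (flat b)).coinduced (projS κ pE a hInv) := by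
  let tp : Ge pE a → Sb pE a b := fun g => ⟨tpOver (flat b) (g • flat b), g, rfl⟩
  have hτ : #(ιb × V) < κ := hM.prod_lt hb.1 hV
  have htp : Function.Surjective tp := by
    rintro ⟨_, g, rfl⟩
    exact ⟨g, rfl⟩
  have hnu : nub κ pE a hInv b ∘ tp = projS κ pE a hInv := by
    ext1 g
    have hspec := (Set.mem_range.mp (tp g).2).choose_spec
    change projS κ pE a hInv (Set.mem_range.mp (tp g).2).choose = _
    set k := (Set.mem_range.mp (tp g).2).choose
    have hs : SameTp (L := L) (Sum.elim (k • flat b) (flat b)) (Sum.elim (g • flat b) (flat b)) :=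
      fun φ => Set.ext_iff.1 hspec φ
    obtain ⟨h, hh⟩ := hM.exists_smul_eq (hM.add_lt hτ hτ) hs
    rw [smul_sumElim, Sum.elim_eq_iff] at hh
    let h₀ : Ge pE a := ⟨h, hbdcl h (congrFun hh.2)⟩
    let _ := galLGroup κ pE a hInv
    have e1 : projHom κ hInv h₀ = 1 := (projS_eq_one hInv hb hh.2).trans (map_one (projHom κ hInv))
    have e2 : projHom κ hInv (g⁻¹ * (h₀ * k)) = 1 := by
      refine (projS_eq_one hInv hb ?_).trans (map_one (projHom κ hInv))
      rw [mul_smul, inv_smul_eq_iff, mul_smul]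
      exact hh.1
    rw [map_mul, map_mul, e1, one_mul, map_inv, inv_mul_eq_one] at e2
    exact e2.symm
  have hind : typeTop pE a (flat b) = (typeSetTop (Sb pE a b)).induced tp := by
    rw [typeSetTop, induced_compose]
    rfl
  refine TopologicalSpace.ext (funext fun s => propext ?_)
  change IsOpen[typeSetTop _] (nub κ pE a hInv b ⁻¹' s) ↔
    IsOpen[typeTop pE a (flat b)] (projS κ pE a hInv ⁻¹' s)
  let _ := typeSetTop (Sb pE a b)
  rw [hind, ← hnu, Set.preimage_comp, isOpen_induced_iff]
  exact ⟨fun h => ⟨_, h, rfl⟩, fun ⟨u, hu, he⟩ => htp.preimage_injective he ▸ hu⟩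

end LascarQuotient

section Statements

variable {γ : Type u} (pE : Set (L.Formula (γ ⊕ γ))) (a : γ → M)
variable {V β : Type u} {pS : Set (L.Formula (V ⊕ β))} {bp : β → M}


/-- Claim 2.16: assuming `e ∈ dcl(Σ)`, the connected component
of the identity satisfies
`Gal_L^0(Σ, e) = ⋂_{e' ∈ acl(e)↾Σ} π_Σ[Aut_{e'e}(𝔠)]`. -/
theorem connectedComponent_eq_sInter_acl (hM : IsMonster κ L M) (hγ : #γ < κ)
    (hE : Equivalence (Frel (M := M) pE)) (hV : #V < κ) (hβ : #β < κ)
    (hInv : SolInv pE a pS bp)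
    (hedcl : eInDclSigma κ pE a pS bp)
    {ιb : Type u} (b : ιb → SolT pS bp)
    (hb : IsLascarTuple κ pE a hInv b) (hbdcl : eInDclTuple pE a (flat b)) :
    @connectedComponent _ (galTopb κ pE a hInv b) (projb κ pE a hInv 1) =
      ⋂₀ {X : Set (GalL κ pE a hInv) |
        ∃ (ι : Type u) (pF : Set (L.Formula ((ι × V) ⊕ (ι × V)))) (c : ι → SolT pS bp),
          #ι < κ ∧ Equivalence (Frel (M := M) pF) ∧ FiniteClass pE a pF (flat c) ∧
          X = projS κ pE a hInv '' {f : Ge pE a | FixesClass pE a f pF (flat c)}} := by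
  let _ := galLGroup κ pE a hInv
  let _ := typeTop pE a (flat b)
  let _ := galTopb κ pE a hInv b
  have hτ : #(ιb × V) < κ := hM.prod_lt hb.1 hV
  let π := projHom κ hInv
  have hπ : ∀ s : Ge pE a, s • flat b = flat b → π s = 1 := fun s hs =>
    (projS_eq_one hInv hb hs).trans (map_one π)
  have hq : Topology.IsQuotientMap π :=
    ⟨⟨galTopb_eq_coinduced hM hV hInv hb hbdcl⟩, projS_surjective hInv⟩
  have hcpt : CompactSpace (Ge pE a) := compactSpace_typeTop hM hE hγ hτ
  have hdiv : Continuous fun p : Ge pE a × Ge pE a => π (p.1⁻¹ * p.2) :=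
    continuous_iff_isClosed.2 fun C hC =>
      isClosed_div_preimage π hM hτ hbdcl hπ (hC.preimage hq.continuous)
  change connectedComponent (1 : GalL κ pE a hInv) = _
  refine Set.Subset.antisymm (Set.subset_sInter ?_) fun x hx => ?_
  · rintro _ ⟨ι, pF, c, hι, hF, hc, rfl⟩
    have hδ : #(ι × V) < κ := hM.prod_lt hι hV
    have hsat : ∀ f g : Ge pE a, π f = π g → f • Fclass pF (flat c) = g • Fclass pF (flat c) := by
      intro f g hfg
      obtain ⟨s, hs, hse⟩ := (projS_eq_iff hInv).1 hfg ι hι c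
      have h := smul_Fclass_of_mem_AutfL hM hδ hF hc hs
      rw [smul_Fclass_ge, hse, flat_toGS_smul, ← smul_Fclass_ge, mul_smul, inv_smul_eq_iff] at h
      exact h.symm
    have hcl : ∀ g : Ge pE a,
        IsClosed (π '' {f | f • Fclass pF (flat c) = g • Fclass pF (flat c)}) := by
      intro g
      rw [← hq.isClosed_preimage]
      convert isClosed_setOf_smul_mem_Fclass π hM hτ hδ hbdcl hπ (pF := pF) (c := flat c)
        (c' := g • flat c) ?_ using 1
      · ext f
        rw [Set.mem_preimage, Set.mem_image, Set.mem_ofPred_eq, ← Fclass_eq_iff hF,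
          ← smul_Fclass_ge, ← smul_Fclass_ge]
        constructor
        · rintro ⟨k, hk, hkf⟩
          rw [← hsat _ _ hkf]
          exact hk.symm
        · intro h
          exact ⟨f, h.symm, rfl⟩
      · intro f k hfk h
        rw [← Fclass_eq_iff hF, ← smul_Fclass_ge, ← smul_Fclass_ge] at h ⊢
        rw [h, hsat _ _ hfk]
    have hX : IsClopen (π '' {f | f • Fclass pF (flat c) = Fclass pF (flat c)}) := by
      refine ⟨by simpa using hcl 1, ?_⟩
      rw [← isClosed_compl_iff]
      have hfin := hc.subset (Set.sdiff_subset (t := {Fclass pF (flat c)}))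
      convert hfin.isClosed_biUnion
        (f := fun o => π '' {f | f • Fclass pF (flat c) = o}) ?_ using 1
      · refine Set.ext fun x => ?_
        simp only [Set.mem_compl_iff, Set.mem_iUnion, exists_prop]
        constructor
        · intro hx
          obtain ⟨g, rfl⟩ := hq.surjective x
          exact ⟨_, ⟨⟨g, rfl⟩, fun hg => hx ⟨g, hg, rfl⟩⟩, g, rfl, rfl⟩
        · rintro ⟨o, ⟨-, ho⟩, g, rfl, rfl⟩ ⟨f, hf, hfg⟩
          exact ho ((hsat _ _ hfg).symm.trans hf)
      · rintro _ ⟨⟨g, rfl⟩, -⟩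
        exact hcl g
    exact hX.connectedComponent_subset ⟨1, one_smul _ _, map_one π⟩
  · by_contra hxn
    obtain ⟨H, hfin, hHcl, hxH⟩ :=
      exists_isClosed_finiteIndex_of_notMem_connectedComponent π hq hdiv hxn
    obtain ⟨pF, hF, hFH⟩ := exists_equivalence_of_isClosed hM hE hγ hτ hbdcl
      (H := H.comap π) (hHcl.preimage hq.continuous)
      fun s hs => by rw [Subgroup.mem_comap, hπ s hs]; exact one_mem H
    have hc : FiniteClass pE a pF (flat b) := by
      have hfin' : (H.comap π).FiniteIndex :=
        ⟨by rw [Subgroup.index_comap_of_surjective _ hq.surjective]; exact hfin.index_ne_zero⟩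
      refine (Set.finite_range fun q : Ge pE a ⧸ H.comap π => q.out • Fclass pF (flat b)).subset ?_
      rintro _ ⟨g, rfl⟩
      refine ⟨(g : Ge pE a ⧸ H.comap π), ?_⟩
      have h := (hFH _).2 (QuotientGroup.eq.1 (Quotient.out_eq (g : Ge pE a ⧸ H.comap π)))
      rw [mul_smul, inv_smul_eq_iff] at h
      exact h.symm
    obtain ⟨f, hf, rfl⟩ := hx _ ⟨ιb, pF, b, hb.1, hF, hc, rfl⟩
    exact hxH ((hFH f).1 hf)

end Statements

end RelLascar
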